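/- Let g ≥ 2. An element of 𝓕 is determined by its set of odd characteristics: if two fundamental systems belonging to 𝓕 have the same g-element set of odd characteristics {η₁,…,η_g}, then they are equal; in particular their (g+2)-element sets of even characteristics coincide. -/

import Mathlib

open scoped Classical BigOperators

noncomputable section

/-- An analytic theta characteristic in dimension `g`: a pair `[η'; η'']` of
vectors in `ℝ^g` (whose entries are intended to lie in `{0, 1/2}`). -/
abbrev ThetaChar (g : ℕ) : Type := (Fin g → ℝ) × (Fin g → ℝ)

/-- All entries of both vectors of the characteristic lie in `{0, 1/2}`. -/
def IsChar {g : ℕ} (η : ThetaChar g) : Prop :=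
  (∀ i, η.1 i = 0 ∨ η.1 i = 1 / 2) ∧ (∀ i, η.2 i = 0 ∨ η.2 i = 1 / 2)

/-- Membership in the Siegel upper half-space `H_g`: a symmetric complex `g×g`
matrix whose imaginary part is positive definite. -/
def IsSiegel {g : ℕ} (τ : Matrix (Fin g) (Fin g) ℂ) : Prop :=
  τ.IsSymm ∧ (τ.map Complex.im).PosDef

/-- The theta function with characteristic `η`:
`θ[η](z;τ) = ∑_{n ∈ ℤ^g} exp(πi·ᵗ(n+η')τ(n+η') + 2πi·ᵗ(n+η')(z+η''))`. -/
def theta {g : ℕ} (η : ThetaChar g) (z : Fin g → ℂ)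
    (τ : Matrix (Fin g) (Fin g) ℂ) : ℂ :=
  ∑' n : Fin g → ℤ,
    Complex.exp
      ((Real.pi : ℂ) * Complex.I *
          ∑ i, ∑ j, ((n i : ℂ) + (η.1 i : ℂ)) * τ i j * ((n j : ℂ) + (η.1 j : ℂ)) +
        2 * (Real.pi : ℂ) * Complex.I *
          ∑ i, ((n i : ℂ) + (η.1 i : ℂ)) * (z i + (η.2 i : ℂ)))

/-- `η` is an even characteristic: `4·ᵗη'η''` is an even integer. -/
def IsEvenChar {g : ℕ} (η : ThetaChar g) : Prop :=
  ∃ k : ℤ, (4 * ∑ i, η.1 i * η.2 i : ℝ) = 2 * (k : ℝ)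

/-- `η` is an odd characteristic. -/
def IsOddChar {g : ℕ} (η : ThetaChar g) : Prop := ¬ IsEvenChar η

/-- Entrywise sum of two characteristics, taken modulo 1. -/
def charAdd {g : ℕ} (η ζ : ThetaChar g) : ThetaChar g :=
  (fun i => Int.fract (η.1 i + ζ.1 i), fun i => Int.fract (η.2 i + ζ.2 i))

/-- Entrywise difference of two characteristics, taken modulo 1. -/
def charSub {g : ℕ} (η ζ : ThetaChar g) : ThetaChar g :=
  (fun i => Int.fract (η.1 i - ζ.1 i), fun i => Int.fract (η.2 i - ζ.2 i))

/-- The Jacobian Nullwert `J(η₁,…,η_g)(τ)`: the determinant of the matrix of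
partial derivatives `∂θ[η_k]/∂z_l` at `z = 0`. -/
def jacobianNullwert {g : ℕ} (η : Fin g → ThetaChar g)
    (τ : Matrix (Fin g) (Fin g) ℂ) : ℂ :=
  Matrix.det (Matrix.of fun k l : Fin g =>
    fderiv ℂ (fun z : Fin g → ℂ => theta (η k) z τ) 0 (Pi.single l 1))

/-- The sign `e(η)`: `+1` if `η` is even, `-1` if odd. -/
def eSign {g : ℕ} (η : ThetaChar g) : ℤ := if IsEvenChar η then 1 else -1

/-- The triple `{a,b,c}` is azygetic: `e(a)e(b)e(c)e(a+b+c) = -1`. -/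
def Azygetic {g : ℕ} (a b c : ThetaChar g) : Prop :=
  eSign a * eSign b * eSign c * eSign (charAdd (charAdd a b) c) = -1

/-- A fundamental system of analytic theta characteristics: a set of `2g+2`
characteristics, `g` of them odd and the remaining `g+2` even, such that every
three-element subset is azygetic. -/
def IsFundamentalSystem (g : ℕ) (F : Finset (ThetaChar g)) : Prop :=
  F.card = 2 * g + 2 ∧ (∀ η ∈ F, IsChar η) ∧
    (F.filter fun η => IsOddChar η).card = g ∧
    ∀ a ∈ F, ∀ b ∈ F, ∀ c ∈ F, a ≠ b → a ≠ c → b ≠ c → Azygetic a b c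

/-- The basic characteristic `η_k` for `1 ≤ k ≤ 2g+2`: for `k = 2k'-1` odd the
top vector has `1/2` in the `k'`-th entry (zero vector if `k' = g+1`) and the
bottom vector has `1/2` in the first `k'-1` entries; for `k = 2k'` even the top
vector has `1/2` in the `k'`-th entry and the bottom vector has `1/2` in the
first `k'` entries. -/
def etaBase (g k : ℕ) : ThetaChar g :=
  (fun i => if (i : ℕ) + 1 = (k + 1) / 2 then 1 / 2 else 0,
   fun i => if (i : ℕ) < k / 2 then 1 / 2 else 0)

/-- `η_S := ∑_{k ∈ S, k ≠ 2g+2} η_k`, the sum taken entrywise modulo 1. -/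
def etaSet (g : ℕ) (S : Finset ℕ) : ThetaChar g :=
  (fun i => Int.fract (∑ k ∈ S.erase (2 * g + 2), (etaBase g k).1 i),
   fun i => Int.fract (∑ k ∈ S.erase (2 * g + 2), (etaBase g k).2 i))

/-- `U = {1, 3, …, 2g+1}`. -/
def Uset (g : ℕ) : Finset ℕ := (Finset.range (g + 1)).image fun j => 2 * j + 1

/-- `i` represents a permutation `(i₁,…,i_{2g+2})` of `(1,…,2g+2)`. -/
def IsPermIndex (g : ℕ) (i : Fin (2 * g + 2) → ℕ) : Prop :=
  Function.Injective i ∧ Finset.image i Finset.univ = Finset.Icc 1 (2 * g + 2)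

/-- Given a permutation `(i₁,…,i_{2g+2})` of `(1,…,2g+2)`, the characteristic
`η_k := η_{T_k ∘ U}` where `T_k = {i₁,…,i_g} ∖ {i_k}` for `1 ≤ k ≤ g` and
`T_k = {i₁,…,i_g} ∪ {i_k}` for `g+1 ≤ k ≤ 2g+2`. -/
def fsChars (g : ℕ) (i : Fin (2 * g + 2) → ℕ) : Fin (2 * g + 2) → ThetaChar g :=
  fun k =>
    let T0 : Finset ℕ :=
      Finset.image i (Finset.univ.filter fun l : Fin (2 * g + 2) => (l : ℕ) < g)
    if (k : ℕ) < g then etaSet g (symmDiff (T0.erase (i k)) (Uset g))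
    else etaSet g (symmDiff (insert (i k) T0) (Uset g))

/-- The system of `2g+2` characteristics obtained from a permutation
`(i₁,…,i_{2g+2})` of `(1,…,2g+2)`. -/
def fsSystem (g : ℕ) (i : Fin (2 * g + 2) → ℕ) : Finset (ThetaChar g) :=
  Finset.image (fsChars g i) Finset.univ

/-- The family `𝓕` of all fundamental systems obtained from permutations of
`(1,…,2g+2)`. -/
def FSfamily (g : ℕ) : Set (Finset (ThetaChar g)) :=
  {F | ∃ i : Fin (2 * g + 2) → ℕ, IsPermIndex g i ∧ F = fsSystem g i}

/-- The indicator of membership in `S`, with values in `ZMod 2`. -/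
def memBit (S : Finset ℕ) (k : ℕ) : ZMod 2 := if k ∈ S then 1 else 0

lemma fract_sum_half (A : Finset ℕ) (p : ℕ → Prop) [DecidablePred p] :
    Int.fract (∑ k ∈ A, if p k then (1 / 2 : ℝ) else 0) =
      (((∑ k ∈ A, if p k then (1 : ZMod 2) else 0).val : ℕ) : ℝ) / 2 := by
  have h : (∑ k ∈ A, if p k then (1 / 2 : ℝ) else 0) = ((A.filter p).card : ℝ) / 2 := by
    rw [← Finset.sum_filter, Finset.sum_const, nsmul_eq_mul]
    ring
  rw [h, Finset.sum_boole, ZMod.val_natCast]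
  exact_mod_cast Int.fract_div_natCast_eq_div_natCast_mod (m := (A.filter p).card) (n := 2)

lemma sum_memBit_eq (A B S : Finset ℕ) (p : ℕ → Prop) [DecidablePred p]
    (h : ∀ k, k ∈ A ∧ p k ↔ k ∈ B ∧ k ∈ S) :
    (∑ k ∈ A, if p k then (1 : ZMod 2) else 0) = ∑ k ∈ B, memBit S k := by
  simp only [memBit]
  rw [← Finset.sum_filter, ← Finset.sum_filter]
  congr 1
  ext k
  simpa only [Finset.mem_filter] using h k

lemma etaSet_fst {g : ℕ} {S : Finset ℕ} (hS : S ⊆ Finset.Icc 1 (2 * g + 2)) (i : Fin g) :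
    (etaSet g S).1 i =
      ((memBit S (2 * i + 1) + memBit S (2 * i + 2)).val : ℝ) / 2 := by
  have hi := i.2
  have hsum : memBit S (2 * i + 1) + memBit S (2 * i + 2) =
      ∑ k ∈ Finset.Ico (2 * (i : ℕ) + 1) (2 * i + 3), memBit S k := by
    rw [Finset.sum_Ico_succ_top (by omega), Finset.sum_Ico_succ_top (by omega)]
    simp
  simp only [etaSet, etaBase]
  rw [fract_sum_half, hsum, sum_memBit_eq]
  intro k
  have := @hS k
  simp only [Finset.mem_Icc, Finset.mem_erase, Finset.mem_Ico] at this ⊢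
  constructor
  · rintro ⟨⟨h1, h2⟩, h3⟩
    exact ⟨by omega, h2⟩
  · rintro ⟨h1, h2⟩
    exact ⟨⟨by omega, h2⟩, by omega⟩

lemma etaSet_snd {g : ℕ} {S : Finset ℕ} (hS : S ⊆ Finset.Icc 1 (2 * g + 2)) (i : Fin g) :
    (etaSet g S).2 i =
      ((∑ k ∈ Finset.Ico (2 * (i : ℕ) + 2) (2 * g + 2), memBit S k).val : ℝ) / 2 := by
  simp only [etaSet, etaBase]
  rw [fract_sum_half, sum_memBit_eq]
  intro k
  have := @hS k
  simp only [Finset.mem_Icc, Finset.mem_erase, Finset.mem_Ico] at this ⊢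
  constructor
  · rintro ⟨⟨h1, h2⟩, h3⟩
    have := this h2
    exact ⟨by omega, h2⟩
  · rintro ⟨h1, h2⟩
    exact ⟨⟨by omega, h2⟩, by omega⟩

/-- The part of `4·ᵗη'η''` for `η = η_S` coming from the entries `i ≥ j`, as an element of `ZMod 2`. -/
def parityForm (g : ℕ) (S : Finset ℕ) (j : ℕ) : ZMod 2 :=
  ∑ i ∈ Finset.Ico j g, (memBit S (2 * i + 1) + memBit S (2 * i + 2)) *
    ∑ k ∈ Finset.Ico (2 * i + 2) (2 * g + 2), memBit S k

lemma isEvenChar_etaSet_iff {g : ℕ} {S : Finset ℕ} (hS : S ⊆ Finset.Icc 1 (2 * g + 2)) :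
    IsEvenChar (etaSet g S) ↔ parityForm g S 0 = 0 := by
  let a : ℕ → ZMod 2 := fun i => memBit S (2 * i + 1) + memBit S (2 * i + 2)
  let b : ℕ → ZMod 2 := fun i => ∑ k ∈ Finset.Ico (2 * i + 2) (2 * g + 2), memBit S k
  have h1 : (4 * ∑ i, (etaSet g S).1 i * (etaSet g S).2 i : ℝ) =
      ((∑ i : Fin g, (a i).val * (b i).val : ℕ) : ℤ) := by
    push_cast
    rw [Finset.mul_sum]
    refine Finset.sum_congr rfl fun i _ => ?_
    rw [etaSet_fst hS, etaSet_snd hS]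
    simp only [a, b]
    ring
  have h2 : parityForm g S 0 = ((∑ i : Fin g, (a i).val * (b i).val : ℕ) : ZMod 2) := by
    push_cast
    simp only [ZMod.natCast_zmod_val]
    rw [parityForm, Nat.Ico_zero_eq_range]
    exact Finset.sum_range fun i => a i * b i
  rw [IsEvenChar, h1, h2, ZMod.natCast_eq_zero_iff]
  constructor
  · rintro ⟨k, hk⟩
    have : ((∑ i : Fin g, (a i).val * (b i).val : ℕ) : ℤ) = 2 * k := by exact_mod_cast hk
    omega
  · rintro ⟨k, hk⟩
    exact ⟨k, by rw [hk]; push_cast; ring⟩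

lemma memBit_symmDiff (S T : Finset ℕ) (k : ℕ) :
    memBit (symmDiff S T) k = memBit S k + memBit T k := by
  simp only [memBit, Finset.mem_symmDiff]
  by_cases h1 : k ∈ S <;> by_cases h2 : k ∈ T <;> simp [h1, h2]
  decide

lemma memBit_Uset_odd {g j : ℕ} (hj : j ≤ g) : memBit (Uset g) (2 * j + 1) = 1 := by
  have : 2 * j + 1 ∈ Uset g := Finset.mem_image.2 ⟨j, by simp; omega, rfl⟩
  simp [memBit, this]

lemma memBit_Uset_even (g j : ℕ) : memBit (Uset g) (2 * j + 2) = 0 := by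
  have : 2 * j + 2 ∉ Uset g := by
    simp only [Uset, Finset.mem_image, not_exists, not_and]
    intro a _
    omega
  simp [memBit, this]

lemma Uset_subset (g : ℕ) : Uset g ⊆ Finset.Icc 1 (2 * g + 2) := by
  intro k
  simp only [Uset, Finset.mem_image, Finset.mem_range, Finset.mem_Icc]
  rintro ⟨a, _, rfl⟩
  omega

/-- The number of elements of `T` in `[2j+1, 2g+1]` minus `g - j`. -/
def excess (g : ℕ) (T : Finset ℕ) (j : ℕ) : ℤ :=
  ∑ k ∈ Finset.Ico (2 * j + 1) (2 * g + 2), (if k ∈ T then 1 else 0) - ((g : ℤ) - j)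

lemma parityForm_symmDiff_Uset (g : ℕ) (T : Finset ℕ) {j : ℕ} (hj : j ≤ g) :
    (∑ k ∈ Finset.Ico (2 * j + 1) (2 * g + 2), memBit (symmDiff T (Uset g)) k =
        (excess g T j : ZMod 2) + 1) ∧
      ∃ m : ℤ, excess g T j * (excess g T j - 1) = 2 * m ∧
        parityForm g (symmDiff T (Uset g)) j = (m : ZMod 2) := by
  induction hj using Nat.decreasingInduction with
  | self =>
    have hI : Finset.Ico (2 * g + 1) (2 * g + 2) = {2 * g + 1} := by
      ext k
      simp only [Finset.mem_Ico, Finset.mem_singleton]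
      omega
    have hp : parityForm g (symmDiff T (Uset g)) g = 0 := by simp [parityForm]
    rw [hp, excess, hI, Finset.sum_singleton, Finset.sum_singleton, memBit_symmDiff,
      memBit_Uset_odd le_rfl, memBit]
    split_ifs
    · exact ⟨by simp, 0, by simp, by simp⟩
    · exact ⟨by simp, 0, by simp, by simp⟩
  | of_succ j hj ih =>
    obtain ⟨hB, m, hm, hR⟩ := ih
    have hsplit {M : Type} [AddCommMonoid M] (f : ℕ → M) :
        ∑ k ∈ Finset.Ico (2 * j + 1) (2 * g + 2), f k = f (2 * j + 1) + (f (2 * j + 2) +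
          ∑ k ∈ Finset.Ico (2 * (j + 1) + 1) (2 * g + 2), f k) := by
      rw [Finset.sum_eq_sum_Ico_succ_bot (by omega), Finset.sum_eq_sum_Ico_succ_bot (by omega)]
      rfl
    have hsplit' {M : Type} [AddCommMonoid M] (f : ℕ → M) :
        ∑ k ∈ Finset.Ico (2 * j + 2) (2 * g + 2), f k = f (2 * j + 2) +
          ∑ k ∈ Finset.Ico (2 * (j + 1) + 1) (2 * g + 2), f k := by
      rw [Finset.sum_eq_sum_Ico_succ_bot (by omega)]
      rfl
    have hD : excess g T j = (if 2 * j + 1 ∈ T then 1 else 0) +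
        (if 2 * j + 2 ∈ T then 1 else 0) - 1 + excess g T (j + 1) := by
      rw [excess, hsplit, excess]
      push_cast
      ring
    have hP : parityForm g (symmDiff T (Uset g)) j =
        (memBit T (2 * j + 1) + 1 + memBit T (2 * j + 2)) *
          (memBit T (2 * j + 2) + ((excess g T (j + 1) : ZMod 2) + 1)) + (m : ZMod 2) := by
      rw [parityForm, Finset.sum_eq_sum_Ico_succ_bot hj, hsplit', hB, ← hR, parityForm]
      simp only [memBit_symmDiff, memBit_Uset_odd hj.le, memBit_Uset_even, add_zero]
    have h2 : (2 : ZMod 2) = 0 := rfl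
    rw [hP, hsplit, hB, hD]
    simp only [memBit_symmDiff, memBit_Uset_odd hj.le, memBit_Uset_even, add_zero]
    generalize excess g T (j + 1) = D at *
    simp only [memBit]
    by_cases h1 : 2 * j + 1 ∈ T <;> by_cases h3 : 2 * j + 2 ∈ T <;>
      simp only [h1, h3, if_true, if_false]
    · exact ⟨by push_cast; linear_combination h2, m + D, by linear_combination hm,
        by push_cast; linear_combination (D + 3 : ZMod 2) * h2⟩
    · exact ⟨by push_cast; linear_combination h2, m, by linear_combination hm,
        by linear_combination (D + 1 : ZMod 2) * h2⟩
    · exact ⟨by push_cast; linear_combination h2, m, by linear_combination hm,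
        by linear_combination (D + 2 : ZMod 2) * h2⟩
    · exact ⟨by push_cast; linear_combination h2, m - D + 1, by linear_combination hm,
        by push_cast; linear_combination (D : ZMod 2) * h2⟩

lemma excess_zero_eq {g : ℕ} {T : Finset ℕ} (hT : T ⊆ Finset.Icc 1 (2 * g + 2)) :
    excess g T 0 = (T.card : ℤ) - g ∨ excess g T 0 = (T.card : ℤ) - g - 1 := by
  have h : ∑ k ∈ Finset.Ico (2 * 0 + 1) (2 * g + 2), (if k ∈ T then (1 : ℤ) else 0) =
      (T.erase (2 * g + 2)).card := by
    rw [Finset.sum_boole]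
    congr 2
    ext k
    have := @hT k
    simp only [Finset.mem_Icc, Finset.mem_filter, Finset.mem_Ico, Finset.mem_erase] at this ⊢
    constructor
    · rintro ⟨h1, h2⟩
      exact ⟨by omega, h2⟩
    · rintro ⟨h1, h2⟩
      have := this h2
      exact ⟨by omega, h2⟩
  rw [excess, h]
  by_cases hk : 2 * g + 2 ∈ T
  · have := Finset.card_erase_add_one hk
    right
    push_cast
    omega
  · rw [Finset.erase_eq_of_notMem hk]
    left
    push_cast
    omega

lemma symmDiff_Uset_subset {g : ℕ} {T : Finset ℕ} (hT : T ⊆ Finset.Icc 1 (2 * g + 2)) :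
    symmDiff T (Uset g) ⊆ Finset.Icc 1 (2 * g + 2) := by
  intro k hk
  rcases Finset.mem_symmDiff.1 hk with h | h
  · exact hT h.1
  · exact Uset_subset g h.1

lemma isEvenChar_of_card {g : ℕ} {T : Finset ℕ} (hT : T ⊆ Finset.Icc 1 (2 * g + 2))
    (hc : T.card = g + 1) : IsEvenChar (etaSet g (symmDiff T (Uset g))) := by
  rw [isEvenChar_etaSet_iff (symmDiff_Uset_subset hT)]
  obtain ⟨-, m, hm, hR⟩ := parityForm_symmDiff_Uset g T (Nat.zero_le g)
  have hm0 : m = 0 := by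
    rcases excess_zero_eq hT with h | h
    · have h' : excess g T 0 = 1 := by omega
      rw [h'] at hm
      omega
    · have h' : excess g T 0 = 0 := by omega
      rw [h'] at hm
      omega
  rw [hR, hm0, Int.cast_zero]

lemma isOddChar_of_card {g : ℕ} {T : Finset ℕ} (hT : T ⊆ Finset.Icc 1 (2 * g + 2))
    (hc : T.card + 1 = g) : IsOddChar (etaSet g (symmDiff T (Uset g))) := by
  rw [IsOddChar, isEvenChar_etaSet_iff (symmDiff_Uset_subset hT)]
  obtain ⟨-, m, hm, hR⟩ := parityForm_symmDiff_Uset g T (Nat.zero_le g)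
  rw [hR]
  rcases excess_zero_eq hT with h | h
  · have h' : excess g T 0 = -1 := by omega
    rw [h'] at hm
    obtain rfl : m = 1 := by omega
    decide
  · have h' : excess g T 0 = -2 := by omega
    rw [h'] at hm
    obtain rfl : m = 3 := by omega
    decide

lemma val_div_two_injective {x y : ZMod 2} (h : (x.val : ℝ) / 2 = (y.val : ℝ) / 2) : x = y := by
  have h' : (x.val : ℝ) = y.val := by linarith
  exact ZMod.val_injective 2 (by exact_mod_cast h')

/-- If `η_S = η_{S'}`, the indicator of the symmetric difference of `S` and `S'` is constant
on `{1, …, 2g+1}`. -/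
lemma memBit_add_eq_of_etaSet_eq {g : ℕ} {S S' : Finset ℕ}
    (hS : S ⊆ Finset.Icc 1 (2 * g + 2)) (hS' : S' ⊆ Finset.Icc 1 (2 * g + 2))
    (h : etaSet g S = etaSet g S') {k : ℕ} (hk : k ≤ 2 * g) :
    memBit S (k + 1) + memBit S' (k + 1) = memBit S 1 + memBit S' 1 := by
  have h2 : (2 : ZMod 2) = 0 := rfl
  have htop (i : ℕ) (hi : i < g) : memBit S (2 * i + 1) + memBit S (2 * i + 2) =
      memBit S' (2 * i + 1) + memBit S' (2 * i + 2) := by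
    apply val_div_two_injective
    have := congrFun (congrArg Prod.fst h) ⟨i, hi⟩
    rwa [etaSet_fst hS, etaSet_fst hS'] at this
  have hbot (i : ℕ) (hi : i ≤ g) :
      ∑ k ∈ Finset.Ico (2 * i + 2) (2 * g + 2), memBit S k =
        ∑ k ∈ Finset.Ico (2 * i + 2) (2 * g + 2), memBit S' k := by
    rcases hi.lt_or_eq with hi | rfl
    · apply val_div_two_injective
      have := congrFun (congrArg Prod.snd h) ⟨i, hi⟩
      rwa [etaSet_snd hS, etaSet_snd hS'] at this
    · simp
  have hbot' (i : ℕ) (hi : i < g) : memBit S (2 * i + 2) + memBit S (2 * i + 3) =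
      memBit S' (2 * i + 2) + memBit S' (2 * i + 3) := by
    have h0 := hbot i hi.le
    have h1 := hbot (i + 1) hi
    rw [Finset.sum_eq_sum_Ico_succ_bot (by omega), Finset.sum_eq_sum_Ico_succ_bot (by omega),
      Finset.sum_eq_sum_Ico_succ_bot (f := memBit S') (by omega),
      Finset.sum_eq_sum_Ico_succ_bot (f := memBit S') (by omega)] at h0
    have e : 2 * (i + 1) + 2 = 2 * i + 2 + 1 + 1 := by ring
    rw [e] at h1
    linear_combination h0 - h1
  induction k with
  | zero => rfl
  | succ k ih =>
    rw [← ih (by omega)]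
    obtain ⟨i, rfl | rfl⟩ := Nat.even_or_odd' k
    · have := htop i (by omega)
      linear_combination this + (memBit S' (2 * i + 2) - memBit S (2 * i + 1)) * h2
    · have := hbot' i (by omega)
      linear_combination this + (memBit S' (2 * i + 3) - memBit S (2 * i + 2)) * h2

lemma mem_iff_of_memBit_add_eq_zero {S S' : Finset ℕ} {k : ℕ}
    (h : memBit S k + memBit S' k = 0) : k ∈ S ↔ k ∈ S' := by
  by_cases h1 : k ∈ S <;> by_cases h2 : k ∈ S' <;> simp_all [memBit]

lemma eq_of_etaSet_symmDiff_eq {g : ℕ} {T T' : Finset ℕ}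
    (hT : T ⊆ Finset.Icc 1 (2 * g + 2)) (hT' : T' ⊆ Finset.Icc 1 (2 * g + 2))
    (hc : T.card = T'.card) (hg : T.card ≤ g)
    (h : etaSet g (symmDiff T (Uset g)) = etaSet g (symmDiff T' (Uset g))) : T = T' := by
  have h2 : (2 : ZMod 2) = 0 := rfl
  have hconst (k : ℕ) (hk : k ≤ 2 * g) :
      memBit T (k + 1) + memBit T' (k + 1) = memBit T 1 + memBit T' 1 := by
    have := memBit_add_eq_of_etaSet_eq (symmDiff_Uset_subset hT) (symmDiff_Uset_subset hT') h hk
    simp only [memBit_symmDiff] at this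
    linear_combination this + (memBit (Uset g) 1 - memBit (Uset g) (k + 1)) * h2
  by_cases h0 : memBit T 1 + memBit T' 1 = 0
  · have herase : T.erase (2 * g + 2) = T'.erase (2 * g + 2) := by
      ext k
      simp only [Finset.mem_erase]
      refine and_congr_right fun hk => ?_
      by_cases hk' : 1 ≤ k ∧ k ≤ 2 * g + 1
      · obtain ⟨k, rfl⟩ := Nat.exists_eq_add_of_le' hk'.1
        exact mem_iff_of_memBit_add_eq_zero ((hconst k (by omega)).trans h0)
      · refine iff_of_false (fun hm => ?_) (fun hm => ?_)
        · have := Finset.mem_Icc.1 (hT hm)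
          omega
        · have := Finset.mem_Icc.1 (hT' hm)
          omega
    have hcard := congrArg Finset.card herase
    by_cases h1 : 2 * g + 2 ∈ T <;> by_cases h3 : 2 * g + 2 ∈ T'
    · rw [← Finset.insert_erase h1, herase, Finset.insert_erase h3]
    · have := Finset.card_erase_add_one h1
      rw [Finset.erase_eq_of_notMem h3] at hcard
      omega
    · have := Finset.card_erase_add_one h3
      rw [Finset.erase_eq_of_notMem h1] at hcard
      omega
    · rwa [Finset.erase_eq_of_notMem h1, Finset.erase_eq_of_notMem h3] at herase
  · exfalso
    have hsub : Finset.Icc 1 (2 * g + 1) ⊆ T ∪ T' := by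
      intro k hk
      rw [Finset.mem_Icc] at hk
      obtain ⟨k, rfl⟩ := Nat.exists_eq_add_of_le' hk.1
      by_contra hmem
      rw [Finset.mem_union, not_or] at hmem
      apply h0
      rw [← hconst k (by omega)]
      simp [memBit, hmem.1, hmem.2]
    have := (Finset.card_le_card hsub).trans (Finset.card_union_le T T')
    rw [Nat.card_Icc] at this
    omega

/-- The system attached to a subset `T` of `{1, …, 2g+2}`: the characteristics
`η_{(T ∖ {x}) ∘ U}` for `x ∈ T` and `η_{(T ∪ {x}) ∘ U}` for `x ∉ T`. -/
def systemOf (g : ℕ) (T : Finset ℕ) : Finset (ThetaChar g) :=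
  T.image (fun x => etaSet g (symmDiff (T.erase x) (Uset g))) ∪
    (Finset.Icc 1 (2 * g + 2) \ T).image fun x => etaSet g (symmDiff (insert x T) (Uset g))

lemma exists_eq_systemOf {g : ℕ} {F : Finset (ThetaChar g)} (hF : F ∈ FSfamily g) :
    ∃ T ⊆ Finset.Icc 1 (2 * g + 2), T.card = g ∧ F = systemOf g T := by
  obtain ⟨i, ⟨hinj, himg⟩, rfl⟩ := hF
  have hmem (l : Fin (2 * g + 2)) :
      i l ∈ Finset.image i (Finset.univ.filter fun l : Fin (2 * g + 2) => (l : ℕ) < g) ↔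
        (l : ℕ) < g := by
    simp [hinj.eq_iff]
  refine ⟨Finset.image i (Finset.univ.filter fun l : Fin (2 * g + 2) => (l : ℕ) < g),
    himg ▸ Finset.image_subset_image (Finset.filter_subset _ _), ?_, ?_⟩
  · rw [Finset.card_image_of_injective _ hinj, Fin.card_filter_val_lt]
    omega
  · rw [systemOf, ← himg]
    generalize hT : Finset.image i
      (Finset.univ.filter fun l : Fin (2 * g + 2) => (l : ℕ) < g) = T at hmem
    ext η
    simp only [fsSystem, fsChars, hT, Finset.mem_image, Finset.mem_union, Finset.mem_sdiff,
      Finset.mem_univ, true_and]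
    constructor
    · rintro ⟨l, rfl⟩
      by_cases hl : (l : ℕ) < g
      · exact Or.inl ⟨i l, (hmem l).2 hl, by rw [if_pos hl]⟩
      · exact Or.inr ⟨i l, ⟨⟨l, rfl⟩, fun h => hl ((hmem l).1 h)⟩, by rw [if_neg hl]⟩
    · rintro (⟨x, hx, rfl⟩ | ⟨x, ⟨⟨l, rfl⟩, hx⟩, rfl⟩)
      · obtain ⟨l, -, rfl⟩ := Finset.mem_image.1 (hT ▸ hx)
        exact ⟨l, by rw [if_pos ((hmem l).1 hx)]⟩
      · exact ⟨l, by rw [if_neg fun h => hx ((hmem l).2 h)]⟩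

lemma filter_isOddChar_systemOf {g : ℕ} {T : Finset ℕ} (hT : T ⊆ Finset.Icc 1 (2 * g + 2))
    (hc : T.card = g) :
    ((systemOf g T).filter fun η => IsOddChar η) =
      T.image fun x => etaSet g (symmDiff (T.erase x) (Uset g)) := by
  rw [systemOf, Finset.filter_union, Finset.filter_true_of_mem, Finset.filter_false_of_mem,
    Finset.union_empty]
  · simp only [Finset.mem_image, Finset.mem_sdiff]
    rintro _ ⟨x, ⟨hx, hxT⟩, rfl⟩
    exact not_not.2 (isEvenChar_of_card (Finset.insert_subset hx hT)
      (by rw [Finset.card_insert_of_notMem hxT, hc]))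
  · simp only [Finset.mem_image]
    rintro _ ⟨x, hx, rfl⟩
    exact isOddChar_of_card ((Finset.erase_subset x T).trans hT)
      (by rw [Finset.card_erase_add_one hx, hc])

/-- An element of `𝓕` is determined by its set of odd characteristics: two
fundamental systems in `𝓕` with the same `g`-element set of odd
characteristics are equal; in particular their sets of even characteristics
coincide. -/
theorem fs_determined_by_odd_part (g : ℕ) (hg : 2 ≤ g)
    (F F' : Finset (ThetaChar g)) (hF : F ∈ FSfamily g) (hF' : F' ∈ FSfamily g)
    (h : (F.filter fun η => IsOddChar η) = (F'.filter fun η => IsOddChar η)) :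
    F = F' ∧ (F.filter fun η => IsEvenChar η) = (F'.filter fun η => IsEvenChar η) := by
  obtain ⟨T, hT, hc, rfl⟩ := exists_eq_systemOf hF
  obtain ⟨T', hT', hc', rfl⟩ := exists_eq_systemOf hF'
  rw [filter_isOddChar_systemOf hT hc, filter_isOddChar_systemOf hT' hc'] at h
  have herase (x : ℕ) (hx : x ∈ T) : T.erase x ⊆ T' := by
    have hmem := Finset.mem_image_of_mem
      (fun x => etaSet g (symmDiff (T.erase x) (Uset g))) hx
    rw [h] at hmem
    obtain ⟨y, hy, hxy⟩ := Finset.mem_image.1 hmem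
    have h1 := Finset.card_erase_add_one hx
    have h2 := Finset.card_erase_add_one hy
    rw [← eq_of_etaSet_symmDiff_eq ((Finset.erase_subset y T').trans hT')
      ((Finset.erase_subset x T).trans hT) (by omega) (by omega) hxy]
    exact Finset.erase_subset y T'
  have hsub : T ⊆ T' := by
    intro x hx
    obtain ⟨y, hy, hyx⟩ := Finset.exists_mem_ne (by omega : 1 < T.card) x
    exact herase y hy (Finset.mem_erase.2 ⟨hyx.symm, hx⟩)
  obtain rfl := Finset.eq_of_subset_of_card_le hsub (by omega)
  exact ⟨rfl, rfl⟩

end
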